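/- (Theorem 1(ii)) Let λ = -1/π and let g ∈ E. Then f ∈ E satisfies the Stieltjes equation f(x) = g(x) + λ ∫₀^∞ f(y)/(x+y) dy for almost every x > 0 if and only if f(x) = g(x) + (2/π²)·x·∫₀^∞ (1/(x² − y²))·(y/x)^{1/2}·ln(y/x)·g(y) dy for almost every x > 0, where the latter integral is absolutely convergent for every x > 0. -/

import Mathlib

open MeasureTheory Set Asymptotics

noncomputable section

/-- `r₁(x;α)` from Dixon's resolvent kernels. -/
def r1 (α : ℂ) (x : ℝ) : ℂ :=
  if α = -(1/2 : ℂ) then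
    -(2 / (Real.pi : ℂ)) * ((x : ℂ) ^ ((1 : ℂ)/2) * (Real.log x : ℂ)) / (1 - (x : ℂ) ^ 2)
  else
    (1 / Complex.cos ((Real.pi : ℂ) * α)) *
      (((x : ℂ) ^ (-α) - (x : ℂ) ^ (α + 1)) / (1 - (x : ℂ) ^ 2))

def r2 (α : ℂ) (x : ℝ) : ℂ := -(1 / (x : ℂ)) * r1 (-α) x

def r3 (α : ℂ) (x : ℝ) : ℂ := (x : ℂ) ^ 2 * r2 α x

def R1 (α : ℂ) (x y : ℝ) : ℂ := (1 / (y : ℂ)) * r1 α (x / y)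
def R2 (α : ℂ) (x y : ℝ) : ℂ := (1 / (y : ℂ)) * r2 α (x / y)
def R3 (α : ℂ) (x y : ℝ) : ℂ := (1 / (y : ℂ)) * r3 α (x / y)

/-- membership in `E`: integrable on `(0,∞)` with weight `1/(1+x)`. -/
def MemE (f : ℝ → ℂ) : Prop :=
  IntegrableOn (fun x : ℝ => f x / (1 + (x : ℂ))) (Ioi 0)

/-- membership in `E_k`: integrable on `(0,∞)` with weight `x^{k-1}`. -/
def MemEk (k : ℝ) (f : ℝ → ℂ) : Prop :=
  IntegrableOn (fun x : ℝ => (x ^ (k - 1) : ℝ) • f x) (Ioi 0)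

/-- membership in `B_{ε,η}`. -/
def MemB (ε η : ℝ) (f : ℝ → ℂ) : Prop :=
  ContinuousOn f (Ioi 0) ∧
  ∃ M : ℝ, (∀ x : ℝ, 1 < x → x ^ ε * ‖f x‖ ≤ M) ∧ (∀ x : ℝ, 0 < x → x < 1 → x ^ η * ‖f x‖ ≤ M)

/-- the norm of `B_{ε,η}`. -/
def Bnorm (ε η : ℝ) (f : ℝ → ℂ) : ℝ :=
  sSup ((fun x : ℝ => x ^ ε * ‖f x‖) '' Ioi 1) + sSup ((fun x : ℝ => x ^ η * ‖f x‖) '' Ioo 0 1)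

/-- admissible weight pair `(φ₁,φ₂)`. -/
def AdmissiblePair (φ₁ φ₂ : ℝ → ℝ) : Prop :=
  ContinuousOn φ₁ (Ioi 0) ∧ ContinuousOn φ₂ (Ioi 0) ∧
  (∀ y : ℝ, 0 < y → (φ₁ y ∈ Ioo (0:ℝ) 1 ∧ φ₂ y ∈ Ioo (0:ℝ) 1 ∧ φ₁ y + φ₂ y = 1)) ∧
  φ₁ =O[Filter.atTop] (fun y : ℝ => 1 / y) ∧
  (fun y : ℝ => φ₁ y - 1) =O[nhdsWithin 0 (Ioi 0)] (fun y : ℝ => y)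

/-- the combined kernel `R₂₃`. -/
def R23 (φ₁ φ₂ : ℝ → ℝ) (α : ℂ) (x y : ℝ) : ℂ :=
  (φ₁ y : ℂ) * R2 α x y + (φ₂ y : ℂ) * R3 α x y


/-- `f` is integrable on `(0,∞)` with integral `v`. -/
def HasIoiIntegral {F : Type*} [NormedAddCommGroup F] [NormedSpace ℝ F] (f : ℝ → F) (v : F) :
    Prop :=
  IntegrableOn f (Ioi 0) ∧ ∫ x in Ioi (0 : ℝ), f x = v

namespace HasIoiIntegral

variable {F : Type*} [NormedAddCommGroup F] [NormedSpace ℝ F] {f g : ℝ → F} {v w : F}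

theorem congr_ae (hf : HasIoiIntegral f v) (h : f =ᵐ[volume.restrict (Ioi 0)] g) :
    HasIoiIntegral g v :=
  ⟨hf.1.congr h, (integral_congr_ae h).symm.trans hf.2⟩

theorem congr (hf : HasIoiIntegral f v) (h : ∀ x, 0 < x → f x = g x) (hv : v = w) :
    HasIoiIntegral g w :=
  hv ▸ hf.congr_ae ((ae_restrict_iff' measurableSet_Ioi).2 (.of_forall h))

theorem add (hf : HasIoiIntegral f v) (hg : HasIoiIntegral g w) :
    HasIoiIntegral (fun x => f x + g x) (v + w) :=
  ⟨hf.1.add hg.1, by rw [integral_add hf.1 hg.1, hf.2, hg.2]⟩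

theorem sub (hf : HasIoiIntegral f v) (hg : HasIoiIntegral g w) :
    HasIoiIntegral (fun x => f x - g x) (v - w) :=
  ⟨hf.1.sub hg.1, by rw [integral_sub hf.1 hg.1, hf.2, hg.2]⟩

theorem const_mul {f : ℝ → ℝ} {v : ℝ} (hf : HasIoiIntegral f v) (c : ℝ) :
    HasIoiIntegral (fun x => c * f x) (c * v) :=
  ⟨hf.1.const_mul c, by rw [integral_const_mul, hf.2]⟩

theorem of_hasDerivAt {G g : ℝ → ℝ} {l : ℝ} (hcont : ContinuousWithinAt G (Ici 0) 0)
    (hderiv : ∀ x ∈ Ioi 0, HasDerivAt G (g x) x) (hpos : ∀ x ∈ Ioi 0, 0 ≤ g x)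
    (hG : Filter.Tendsto G Filter.atTop (nhds l)) : HasIoiIntegral g (l - G 0) :=
  ⟨integrableOn_Ioi_deriv_of_nonneg hcont hderiv hpos hG,
    integral_Ioi_of_hasDerivAt_of_nonneg hcont hderiv hpos hG⟩

/-- Fubini's theorem for the composition of two nonnegative kernels. -/
theorem kernel_comp [CompleteSpace F] {A : ℝ → ℝ} {B : ℝ → ℝ → ℝ} {C : ℝ → ℝ} (hA : Measurable A)
    (hB : Measurable (Function.uncurry B)) (hA0 : ∀ z, 0 < z → 0 ≤ A z)
    (hB0 : ∀ z y, 0 < z → 0 < y → 0 ≤ B z y)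
    (hf : AEStronglyMeasurable f (volume.restrict (Ioi 0)))
    (hC : ∀ᵐ y ∂volume.restrict (Ioi 0), HasIoiIntegral (fun z => A z * B z y) (C y))
    (hCf : HasIoiIntegral (fun y => C y • f y) v) :
    HasIoiIntegral (fun z => A z • ∫ y in Ioi (0 : ℝ), B z y • f y) v := by
  have hpos : ∀ᵐ z ∂volume.restrict (Ioi (0 : ℝ)), 0 < z := ae_restrict_mem measurableSet_Ioi
  have hmeas : AEStronglyMeasurable (fun p : ℝ × ℝ => (A p.1 * B p.1 p.2) • f p.2)
      ((volume.restrict (Ioi 0)).prod (volume.restrict (Ioi 0))) :=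
    ((hA.comp measurable_fst).mul hB).aestronglyMeasurable.smul hf.comp_snd
  have hint : Integrable (fun p : ℝ × ℝ => (A p.1 * B p.1 p.2) • f p.2)
      ((volume.restrict (Ioi 0)).prod (volume.restrict (Ioi 0))) := by
    refine (integrable_prod_iff' hmeas).2 ⟨?_, hCf.1.norm.congr ?_⟩
    · filter_upwards [hC] with y hy
      exact hy.1.smul_const (f y)
    · filter_upwards [hC, hpos] with y hy hy0
      have h0 : 0 ≤ C y := hy.2 ▸ setIntegral_nonneg measurableSet_Ioi
        fun z hz => mul_nonneg (hA0 z hz) (hB0 z y hz hy0)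
      have : ∀ᵐ z ∂volume.restrict (Ioi (0 : ℝ)),
          ‖(A z * B z y) • f y‖ = (A z * B z y) * ‖f y‖ := by
        filter_upwards [hpos] with z hz
        rw [norm_smul, Real.norm_of_nonneg (mul_nonneg (hA0 z hz) (hB0 z y hz hy0))]
      rw [integral_congr_ae this, integral_mul_const, hy.2, norm_smul, Real.norm_of_nonneg h0]
  have hA' (z : ℝ) : ∫ y in Ioi (0 : ℝ), (A z * B z y) • f y
      = A z • ∫ y in Ioi (0 : ℝ), B z y • f y := by
    simp_rw [mul_smul]
    exact integral_smul _ _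
  refine ⟨hint.integral_prod_left.congr (.of_forall hA'), ?_⟩
  simp_rw [← hA']
  rw [integral_integral_swap hint, ← hCf.2]
  refine integral_congr_ae ?_
  filter_upwards [hC] with y hy
  rw [integral_smul_const, hy.2]

end HasIoiIntegral

theorem hasIoiIntegral_inv_sqrt_div_add {x : ℝ} (hx : 0 < x) :
    HasIoiIntegral (fun z => (√z)⁻¹ / (x + z)) (Real.pi / √x) := by
  have hsx := Real.sqrt_pos.2 hx
  have key := HasIoiIntegral.of_hasDerivAt (G := fun z => 2 / √x * Real.arctan (√z / √x))
    (g := fun z => (√z)⁻¹ / (x + z)) (l := 2 / √x * (Real.pi / 2)) (by fun_prop) ?_ ?_ ?_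
  · convert key using 1
    simp
  · intro z (hz : 0 < z)
    have hsz := Real.sqrt_pos.2 hz
    convert! ((((hasDerivAt_id z).sqrt hz.ne').div_const (√x)).arctan).const_mul (2 / √x) using 1
    have h1 := Real.sq_sqrt hx.le
    have h2 := Real.sq_sqrt hz.le
    have h3 : x + z ≠ 0 := by positivity
    simp only [id]
    rw [div_pow, h1, h2]
    field_simp
    nlinarith
  · intro z (hz : 0 < z)
    positivity
  · refine (Filter.Tendsto.comp (tendsto_nhds_of_tendsto_nhdsWithin Real.tendsto_arctan_atTop)
      (Real.tendsto_sqrt_atTop.atTop_div_const hsx)).const_mul _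

theorem sq_sub_sq_ne_zero {x y : ℝ} (hx : 0 < x) (hy : 0 < y) (hxy : x ≠ y) :
    y ^ 2 - x ^ 2 ≠ 0 := by
  rw [sq_sub_sq]
  exact mul_ne_zero (by positivity) (sub_ne_zero.2 hxy.symm)

theorem hasIoiIntegral_id_div_mul {x y : ℝ} (hx : 0 < x) (hy : 0 < y) (hxy : x ≠ y) :
    HasIoiIntegral (fun w => w / ((w ^ 2 + x ^ 2) * (w ^ 2 + y ^ 2)))
      (Real.log (y / x) / (y ^ 2 - x ^ 2)) := by
  have hne := sq_sub_sq_ne_zero hx hy hxy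
  have key := HasIoiIntegral.of_hasDerivAt
    (G := fun w => 1 / (2 * (y ^ 2 - x ^ 2)) * Real.log ((w ^ 2 + x ^ 2) / (w ^ 2 + y ^ 2)))
    (g := fun w => w / ((w ^ 2 + x ^ 2) * (w ^ 2 + y ^ 2)))
    (l := 1 / (2 * (y ^ 2 - x ^ 2)) * Real.log 1) ?_ ?_ ?_ ?_
  · convert key using 1
    have : Real.log ((0 ^ 2 + x ^ 2) / (0 ^ 2 + y ^ 2)) = - (2 * Real.log (y / x)) := by
      rw [Real.log_div (by positivity) (by positivity), Real.log_div hy.ne' hx.ne']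
      simp
      ring
    rw [this]
    field_simp
    simp
  · refine ContinuousAt.continuousWithinAt ?_
    have : (0 ^ 2 + x ^ 2) / (0 ^ 2 + y ^ 2) ≠ 0 := by positivity
    have : (0:ℝ) ^ 2 + y ^ 2 ≠ 0 := by positivity
    fun_prop (disch := assumption)
  · intro w hw
    have h2 : w ^ 2 + y ^ 2 ≠ 0 := by positivity
    have h1 : w ^ 2 + x ^ 2 ≠ 0 := by positivity
    convert! ((((hasDerivAt_pow 2 w).add_const (x ^ 2)).div
      ((hasDerivAt_pow 2 w).add_const (y ^ 2)) h2).log (div_ne_zero h1 h2)).const_mul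
        (1 / (2 * (y ^ 2 - x ^ 2))) using 1
    field_simp
    simp only [Pi.div_apply, Nat.cast_ofNat, Nat.add_one_sub_one, pow_one]
    field_simp
    ring
  · intro w (hw : 0 < w)
    positivity
  · refine ((Real.continuousAt_log one_ne_zero).tendsto.comp ?_).const_mul _
    have h : Filter.Tendsto (fun w : ℝ => 1 - (y ^ 2 - x ^ 2) / (w ^ 2 + y ^ 2)) Filter.atTop
        (nhds (1 - 0)) := by
      refine tendsto_const_nhds.sub (tendsto_const_nhds.div_atTop ?_)
      exact Filter.tendsto_atTop_add_const_right _ _ (Filter.tendsto_pow_atTop two_ne_zero)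
    rw [sub_zero] at h
    refine h.congr fun w => ?_
    have h2 : w ^ 2 + y ^ 2 ≠ 0 := by positivity
    field_simp
    ring

section Quartic

variable {b w : ℝ}

theorem hasDerivAt_arctan_add_arctan (hb : 0 < b) (hw : b ^ 2 = 2 * w) (v : ℝ) :
    HasDerivAt (fun v => Real.arctan ((2 * v + b) / b) + Real.arctan ((2 * v - b) / b))
      (b * (v ^ 2 + w) / (v ^ 4 + w ^ 2)) v := by
  obtain rfl : w = b ^ 2 / 2 := by linarith
  have h1 := (((((hasDerivAt_id v).const_mul 2).add_const b).div_const b).arctan).add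
    (((((hasDerivAt_id v).const_mul 2).sub_const b).div_const b).arctan)
  convert! h1 using 1
  have e1 : 0 < b ^ 2 + (2 * v + b) ^ 2 := by positivity
  have e2 : 0 < b ^ 2 + (2 * v - b) ^ 2 := by positivity
  have e3 : 0 < v ^ 4 * 2 ^ 2 + b ^ 4 := by positivity
  simp only [id, mul_one]
  field_simp
  ring

theorem sq_sub_mul_add_pos (hb : 0 < b) (hw : b ^ 2 = 2 * w) (v : ℝ) :
    0 < v ^ 2 - b * v + w := by
  nlinarith [sq_nonneg (v - b / 2), pow_pos hb 2]

theorem hasDerivAt_log_quadratic_div (hb : 0 < b) (hw : b ^ 2 = 2 * w) (v : ℝ) :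
    HasDerivAt (fun v => Real.log ((v ^ 2 + b * v + w) / (v ^ 2 - b * v + w)))
      (2 * b * (w - v ^ 2) / (v ^ 4 + w ^ 2)) v := by
  have e1 : v ^ 2 - b * v + w ≠ 0 := (sq_sub_mul_add_pos hb hw v).ne'
  have e2 : v ^ 2 + b * v + w ≠ 0 := by
    have := sq_sub_mul_add_pos hb hw (-v)
    ring_nf at this ⊢
    exact this.ne'
  have hw0 : 0 < w := by nlinarith [pow_pos hb 2]
  have h1 := ((((hasDerivAt_pow 2 v).add ((hasDerivAt_id v).const_mul b)).add_const w).div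
    (((hasDerivAt_pow 2 v).sub ((hasDerivAt_id v).const_mul b)).add_const w) e1).log
      (div_ne_zero e2 e1)
  convert! h1 using 1
  simp only [Pi.add_apply, Pi.sub_apply, Pi.div_apply, id, Nat.cast_ofNat, Nat.add_one_sub_one, pow_one, mul_one]
  have e3 : v ^ 4 + w ^ 2 = (v ^ 2 + b * v + w) * (v ^ 2 - b * v + w) := by
    linear_combination v ^ 2 * hw
  have e4 : (2 * v + b) * (v ^ 2 - b * v + w) - (v ^ 2 + b * v + w) * (2 * v - b)
      = 2 * b * (w - v ^ 2) := by ring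
  rw [e3, e4]
  generalize v ^ 2 - b * v + w = p at *
  generalize v ^ 2 + b * v + w = q at *
  field_simp

theorem tendsto_arctan_add_arctan (hb : 0 < b) :
    Filter.Tendsto (fun v => Real.arctan ((2 * v + b) / b) + Real.arctan ((2 * v - b) / b))
      Filter.atTop (nhds Real.pi) := by
  have h := tendsto_nhds_of_tendsto_nhdsWithin Real.tendsto_arctan_atTop
  have h2 : Filter.Tendsto (fun v : ℝ => 2 * v) Filter.atTop Filter.atTop :=
    Filter.tendsto_id.const_mul_atTop two_pos
  have := (h.comp ((Filter.tendsto_atTop_add_const_right _ b h2).atTop_div_const hb)).add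
    (h.comp ((Filter.tendsto_atTop_add_const_right _ (-b) h2).atTop_div_const hb))
  rwa [add_halves] at this

theorem tendsto_log_quadratic_div (hb : 0 < b) (hw : b ^ 2 = 2 * w) :
    Filter.Tendsto (fun v => Real.log ((v ^ 2 + b * v + w) / (v ^ 2 - b * v + w)))
      Filter.atTop (nhds 0) := by
  rw [← Real.log_one]
  refine (Real.continuousAt_log one_ne_zero).tendsto.comp ?_
  have h : Filter.Tendsto (fun v : ℝ => 1 + 2 * b / (v + -b + w / v)) Filter.atTop
      (nhds (1 + 0)) := by
    refine tendsto_const_nhds.add (tendsto_const_nhds.div_atTop ?_)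
    exact (Filter.tendsto_atTop_add_const_right _ _ Filter.tendsto_id).atTop_add
      (tendsto_const_nhds.div_atTop Filter.tendsto_id)
  rw [add_zero] at h
  refine h.congr' ?_
  filter_upwards [Filter.eventually_gt_atTop 0] with v hv
  have e1 := (sq_sub_mul_add_pos hb hw v).ne'
  have e2 : v + -b + w / v = (v ^ 2 - b * v + w) / v := by field_simp; ring
  have e3 : v ^ 2 + b * v + w = (v ^ 2 - b * v + w) + 2 * b * v := by ring
  rw [e2, e3]
  generalize v ^ 2 - b * v + w = p at *
  field_simp

/-- The substitution `z = v²` in an improper integral over `(0,∞)`. -/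
theorem HasIoiIntegral.comp_sqrt {G g h : ℝ → ℝ} {l : ℝ}
    (hderiv : ∀ v, HasDerivAt G (g v) v) (hh : ∀ z, 0 < z → h z = g (√z) / (2 * √z))
    (hpos : ∀ v, 0 < v → 0 ≤ g v) (hG : Filter.Tendsto G Filter.atTop (nhds l)) (h0 : G 0 = 0) :
    HasIoiIntegral h l := by
  have hc : Continuous G := continuous_iff_continuousAt.2 fun v => (hderiv v).continuousAt
  have key := HasIoiIntegral.of_hasDerivAt (G := fun z => G (√z)) (g := h) (l := l)
    (hc.comp Real.continuous_sqrt).continuousWithinAt ?_ ?_ (hG.comp Real.tendsto_sqrt_atTop)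
  · simpa [h0] using key
  · intro z (hz : 0 < z)
    have := (hderiv (√z)).comp z ((hasDerivAt_id z).sqrt hz.ne')
    rw [hh z hz]
    convert! this using 1
    simp only [id]
    ring
  · intro z (hz : 0 < z)
    have := hpos (√z) (Real.sqrt_pos.2 hz)
    rw [hh z hz]
    positivity

theorem arctan_add_arctan_zero :
    Real.arctan ((2 * 0 + b) / b) + Real.arctan ((2 * 0 - b) / b) = 0 := by
  rw [mul_zero, zero_add, zero_sub, neg_div, Real.arctan_neg, add_neg_cancel]

theorem log_quadratic_div_zero (hw : 0 < w) :
    Real.log ((0 ^ 2 + b * 0 + w) / (0 ^ 2 - b * 0 + w)) = 0 := by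
  simp [hw.ne']

theorem hasIoiIntegral_sqrt_div (hw : 0 < w) :
    HasIoiIntegral (fun z => √z / (z ^ 2 + w ^ 2)) (Real.pi / √(2 * w)) := by
  have hb : 0 < √(2 * w) := by positivity
  have hbw : √(2 * w) ^ 2 = 2 * w := Real.sq_sqrt (by positivity)
  set b := √(2 * w)
  refine HasIoiIntegral.comp_sqrt (g := fun v => 2 * v ^ 2 / (v ^ 4 + w ^ 2))
    (G := fun v => (1 / b) * ((Real.arctan ((2 * v + b) / b) + Real.arctan ((2 * v - b) / b))
      - (1 / 2) * Real.log ((v ^ 2 + b * v + w) / (v ^ 2 - b * v + w))))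
    (fun v => ?_) (fun z hz => ?_) (fun v hv => by positivity) ?_ ?_
  · convert! ((hasDerivAt_arctan_add_arctan hb hbw v).sub
      ((hasDerivAt_log_quadratic_div hb hbw v).const_mul (1 / 2))).const_mul (1 / b) using 1
    field_simp
    ring
  · have h1 := Real.sq_sqrt hz.le
    have h2 : √z ^ 4 = z ^ 2 := by rw [show √z ^ 4 = (√z ^ 2) ^ 2 by ring, h1]
    have h3 := Real.sqrt_pos.2 hz
    rw [h2]
    field_simp
  · convert ((tendsto_arctan_add_arctan hb).sub
      ((tendsto_log_quadratic_div hb hbw).const_mul (1 / 2))).const_mul (1 / b) using 2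
    ring
  · simp only [arctan_add_arctan_zero, log_quadratic_div_zero (b := b) hw]
    ring

theorem hasIoiIntegral_inv_sqrt_div (hw : 0 < w) :
    HasIoiIntegral (fun z => (√z)⁻¹ / (z ^ 2 + w ^ 2)) (Real.pi / (w * √(2 * w))) := by
  have hb : 0 < √(2 * w) := by positivity
  have hbw : √(2 * w) ^ 2 = 2 * w := Real.sq_sqrt (by positivity)
  set b := √(2 * w)
  refine HasIoiIntegral.comp_sqrt (g := fun v => 2 / (v ^ 4 + w ^ 2))
    (G := fun v => (1 / (w * b)) * ((Real.arctan ((2 * v + b) / b)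
      + Real.arctan ((2 * v - b) / b))
      + (1 / 2) * Real.log ((v ^ 2 + b * v + w) / (v ^ 2 - b * v + w))))
    (fun v => ?_) (fun z hz => ?_) (fun v hv => by positivity) ?_ ?_
  · convert! ((hasDerivAt_arctan_add_arctan hb hbw v).add
      ((hasDerivAt_log_quadratic_div hb hbw v).const_mul (1 / 2))).const_mul (1 / (w * b)) using 1
    field_simp
    ring
  · have h1 := Real.sq_sqrt hz.le
    have h2 : √z ^ 4 = z ^ 2 := by rw [show √z ^ 4 = (√z ^ 2) ^ 2 by ring, h1]
    have h3 := Real.sqrt_pos.2 hz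
    rw [h2]
    field_simp
  · convert ((tendsto_arctan_add_arctan hb).add
      ((tendsto_log_quadratic_div hb hbw).const_mul (1 / 2))).const_mul (1 / (w * b)) using 2
    ring
  · simp only [arctan_add_arctan_zero, log_quadratic_div_zero (b := b) hw]
    ring

end Quartic

theorem hasIoiIntegral_sqrt_div_mul {x w : ℝ} (hx : 0 < x) (hw : 0 < w) :
    HasIoiIntegral (fun z => (x + z)⁻¹ * (√z / (z ^ 2 + w ^ 2)))
      (Real.pi / (x ^ 2 + w ^ 2) * ((x + w) / √(2 * w) - √x)) := by
  refine ((((hasIoiIntegral_sqrt_div hw).const_mul (x / (x ^ 2 + w ^ 2))).add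
    ((hasIoiIntegral_inv_sqrt_div hw).const_mul (w ^ 2 / (x ^ 2 + w ^ 2)))).sub
    ((hasIoiIntegral_inv_sqrt_div_add hx).const_mul (x / (x ^ 2 + w ^ 2)))).congr
    (fun z hz => ?_) ?_
  · have h1 := Real.sq_sqrt hz.le
    have h2 := Real.sqrt_pos.2 hz
    have h3 : 0 < x + z := by positivity
    have h4 : √z ^ 3 = z * √z := by rw [← h1]; simp; ring
    field_simp
    simp only [h1]
    field_simp
    ring
  · have h1 := Real.sq_sqrt hx.le
    have h2 := Real.sqrt_pos.2 hx
    have h3 : 0 < √(2 * w) := by positivity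
    generalize √(2 * w) = r at *
    field_simp
    linear_combination r * h1

theorem hasIoiIntegral_iterated {x y : ℝ} (hx : 0 < x) (hy : 0 < y) (hxy : x ≠ y) :
    HasIoiIntegral (fun w => (Real.pi / (x ^ 2 + w ^ 2) * ((x + w) / √(2 * w) - √x)) *
        (w * √y / (w ^ 2 + y ^ 2)))
      (Real.pi ^ 2 / (2 * (x + y))
        - Real.pi * (√(x * y) * (Real.log (y / x) / (y ^ 2 - x ^ 2)))) := by
  have hne := sq_sub_sq_ne_zero hx hy hxy
  refine (((((hasIoiIntegral_sqrt_div hx).sub (hasIoiIntegral_sqrt_div hy)).const_mul x).add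
    (((hasIoiIntegral_inv_sqrt_div hy).const_mul (y ^ 2)).sub
      ((hasIoiIntegral_inv_sqrt_div hx).const_mul (x ^ 2)))).const_mul
      (Real.pi * √y / √2 / (y ^ 2 - x ^ 2))).sub
    ((hasIoiIntegral_id_div_mul hx hy hxy).const_mul (Real.pi * √(x * y))) |>.congr
    (fun w hw => ?_) ?_
  · obtain ⟨s, hs, rfl⟩ : ∃ s, 0 < s ∧ w = s ^ 2 :=
      ⟨√w, Real.sqrt_pos.2 hw, (Real.sq_sqrt hw.le).symm⟩
    have h1 : 0 < √2 := by positivity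
    rw [Real.sqrt_mul hx.le, Real.sqrt_mul two_pos.le, Real.sqrt_sq hs.le]
    generalize √2 = r at *
    generalize √x = p at *
    generalize √y = q at *
    field_simp
    ring
  · obtain ⟨p, hp, rfl⟩ : ∃ p, 0 < p ∧ x = p ^ 2 :=
      ⟨√x, Real.sqrt_pos.2 hx, (Real.sq_sqrt hx.le).symm⟩
    obtain ⟨q, hq, rfl⟩ : ∃ q, 0 < q ∧ y = q ^ 2 :=
      ⟨√y, Real.sqrt_pos.2 hy, (Real.sq_sqrt hy.le).symm⟩
    have h1 : 0 < √2 := by positivity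
    have h2 : √2 ^ 2 = 2 := Real.sq_sqrt two_pos.le
    rw [Real.sqrt_mul two_pos.le, Real.sqrt_mul two_pos.le, Real.sqrt_mul hx.le,
      Real.sqrt_sq hp.le, Real.sqrt_sq hq.le, ← mul_assoc]
    have h3 : q ^ 4 - p ^ 4 ≠ 0 := by rwa [← pow_mul, ← pow_mul] at hne
    congr 1
    · field_simp
      rw [h2]
      field_simp
      ring
    · ring

/-- The kernel of the Stieltjes transform divided by `π`. -/
def stieltjesKernel (x y : ℝ) : ℝ := Real.pi⁻¹ * (x + y)⁻¹

/-- The resolvent kernel of the Stieltjes transform at `-1/π`. -/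
def logKernel (x y : ℝ) : ℝ :=
  2 / Real.pi ^ 2 * (√(x * y) * (Real.log (y / x) / (y ^ 2 - x ^ 2)))

theorem stieltjesKernel_comm (x y : ℝ) : stieltjesKernel x y = stieltjesKernel y x := by
  rw [stieltjesKernel, stieltjesKernel, add_comm]

theorem logKernel_comm (x y : ℝ) : logKernel x y = logKernel y x := by
  rw [logKernel, logKernel, mul_comm x y, ← inv_div x y, Real.log_inv, ← neg_sub (x ^ 2) (y ^ 2),
    neg_div_neg_eq]

theorem measurable_stieltjesKernel : Measurable (Function.uncurry stieltjesKernel) := by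
  unfold stieltjesKernel Function.uncurry
  fun_prop

theorem measurable_logKernel : Measurable (Function.uncurry logKernel) := by
  unfold logKernel Function.uncurry
  fun_prop

theorem stieltjesKernel_nonneg {x y : ℝ} (hx : 0 < x) (hy : 0 < y) : 0 ≤ stieltjesKernel x y := by
  unfold stieltjesKernel
  positivity

theorem logKernel_nonneg {x y : ℝ} (hx : 0 < x) (hy : 0 < y) : 0 ≤ logKernel x y := by
  refine mul_nonneg (by positivity) (mul_nonneg (by positivity) ?_)
  rcases le_total x y with h | h
  · exact div_nonneg (Real.log_nonneg ((one_le_div hx).2 h)) (by nlinarith)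
  · exact div_nonneg_of_nonpos (Real.log_nonpos (by positivity) ((div_le_one hx).2 h))
      (by nlinarith)

theorem ae_Ioi_pos_ne (y : ℝ) : ∀ᵐ z ∂volume.restrict (Ioi (0 : ℝ)), 0 < z ∧ y ≠ z := by
  filter_upwards [ae_restrict_mem measurableSet_Ioi, Measure.ae_ne (volume.restrict (Ioi 0)) y]
    with z hz hzy
  exact ⟨hz, hzy.symm⟩

theorem hasIoiIntegral_stieltjesKernel_mul_logKernel {x y : ℝ} (hx : 0 < x) (hy : 0 < y)
    (hxy : x ≠ y) :
    HasIoiIntegral (fun z => stieltjesKernel x z * logKernel z y)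
      (stieltjesKernel x y - logKernel x y) := by
  have key := HasIoiIntegral.kernel_comp (A := fun z => (x + z)⁻¹)
    (B := fun z w => √z / (z ^ 2 + w ^ 2)) (f := fun w => w * √y / (w ^ 2 + y ^ 2))
    (by fun_prop) (by unfold Function.uncurry; fun_prop) (fun z hz => by positivity)
    (fun z w hz hw => by positivity)
    (by fun_prop : Measurable _).aestronglyMeasurable
    (by filter_upwards [ae_Ioi_pos_ne 0] with w hw using hasIoiIntegral_sqrt_div_mul hx hw.1)
    (hasIoiIntegral_iterated hx hy hxy)
  refine ((key.const_mul (2 / Real.pi ^ 3)).congr_ae ?_).congr (fun _ _ => rfl) ?_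
  · filter_upwards [ae_Ioi_pos_ne y] with z ⟨hz, hzy⟩
    have h := ((hasIoiIntegral_id_div_mul hz hy hzy.symm).const_mul (√z * √y)).2
    have e : ∫ w in Ioi (0 : ℝ), (√z / (z ^ 2 + w ^ 2)) • (w * √y / (w ^ 2 + y ^ 2))
        = √z * √y * (Real.log (y / z) / (y ^ 2 - z ^ 2)) := by
      rw [← h]
      refine integral_congr_ae (.of_forall fun w => ?_)
      simp only [smul_eq_mul]
      rw [add_comm (z ^ 2), div_mul_div_comm, mul_div_assoc']
      congr 1
      ring
    rw [e, stieltjesKernel, logKernel, Real.sqrt_mul hz.le, smul_eq_mul]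
    have hpi := Real.pi_pos
    field_simp
  · rw [stieltjesKernel, logKernel]
    have hpi := Real.pi_pos
    field_simp

theorem logKernel_le_stieltjesKernel {x y : ℝ} (hx : 0 < x) (hy : 0 < y) (hxy : x ≠ y) :
    logKernel x y ≤ stieltjesKernel x y := by
  rw [← sub_nonneg, ← (hasIoiIntegral_stieltjesKernel_mul_logKernel hx hy hxy).2]
  exact setIntegral_nonneg measurableSet_Ioi fun z hz =>
    mul_nonneg (stieltjesKernel_nonneg hx hz) (logKernel_nonneg hz hy)

theorem hasIoiIntegral_logKernel_mul_stieltjesKernel {x y : ℝ} (hx : 0 < x) (hy : 0 < y)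
    (hxy : x ≠ y) :
    HasIoiIntegral (fun z => logKernel x z * stieltjesKernel z y)
      (stieltjesKernel x y - logKernel x y) :=
  (hasIoiIntegral_stieltjesKernel_mul_logKernel hy hx hxy.symm).congr
    (fun z _ => by rw [stieltjesKernel_comm y, logKernel_comm z, mul_comm])
    (by rw [stieltjesKernel_comm, logKernel_comm])

namespace MemE

variable {f : ℝ → ℂ} {x : ℝ}

theorem aestronglyMeasurable (hf : MemE f) :
    AEStronglyMeasurable f (volume.restrict (Ioi 0)) := by
  have h : AEStronglyMeasurable (fun x : ℝ => (1 + (x : ℂ)) * (f x / (1 + (x : ℂ))))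
      (volume.restrict (Ioi 0)) :=
    ((by fun_prop : Measurable fun x : ℝ => 1 + (x : ℂ)).aestronglyMeasurable).mul
      (Integrable.aestronglyMeasurable hf)
  refine h.congr ?_
  filter_upwards [ae_restrict_mem measurableSet_Ioi] with x (hx : 0 < x)
  have : 1 + (x : ℂ) ≠ 0 := by
    exact_mod_cast (by positivity : (1 : ℝ) + x ≠ 0)
  exact mul_div_cancel₀ _ this

theorem integrableOn_stieltjesKernel (hf : MemE f) (hx : 0 < x) :
    IntegrableOn (fun y => stieltjesKernel x y • f y) (Ioi 0) := by
  refine (Integrable.norm hf).const_mul (Real.pi⁻¹ * max 1 x⁻¹) |>.mono'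
    (((measurable_stieltjesKernel.comp measurable_prodMk_left).aestronglyMeasurable).smul
      hf.aestronglyMeasurable) ?_
  filter_upwards [ae_restrict_mem measurableSet_Ioi] with y (hy : 0 < y)
  have h1 : ‖1 + (y : ℂ)‖ = 1 + y := by
    rw [← Complex.ofReal_one, ← Complex.ofReal_add, Complex.norm_of_nonneg (by positivity)]
  rw [norm_smul, Real.norm_of_nonneg (stieltjesKernel_nonneg hx hy), norm_div, h1, stieltjesKernel,
    mul_assoc, mul_assoc]
  refine mul_le_mul_of_nonneg_left ?_ (by positivity)
  rw [mul_div_assoc', mul_comm, ← div_eq_mul_inv, div_le_div_iff₀ (by positivity) (by positivity)]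
  have h2 : 1 + y ≤ max 1 x⁻¹ * (x + y) := by
    have h3 : 1 ≤ max 1 x⁻¹ * x := by
      calc 1 = x⁻¹ * x := (inv_mul_cancel₀ hx.ne').symm
        _ ≤ _ := by gcongr; exact le_max_right _ _
    nlinarith [le_max_left 1 x⁻¹]
  nlinarith [norm_nonneg (f y)]

theorem integrableOn_logKernel (hf : MemE f) (hx : 0 < x) :
    IntegrableOn (fun y => logKernel x y • f y) (Ioi 0) := by
  refine (hf.integrableOn_stieltjesKernel hx).norm.mono'
    (((measurable_logKernel.comp measurable_prodMk_left).aestronglyMeasurable).smul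
      hf.aestronglyMeasurable) ?_
  filter_upwards [ae_Ioi_pos_ne x] with y ⟨hy, hxy⟩
  rw [norm_smul, norm_smul, Real.norm_of_nonneg (stieltjesKernel_nonneg hx hy),
    Real.norm_of_nonneg (logKernel_nonneg hx hy)]
  gcongr
  exact logKernel_le_stieltjesKernel hx hy hxy

theorem hasIoiIntegral_sub_smul (hf : MemE f) (hx : 0 < x) :
    HasIoiIntegral (fun y => (stieltjesKernel x y - logKernel x y) • f y)
      ((∫ y in Ioi (0 : ℝ), stieltjesKernel x y • f y)
        - ∫ y in Ioi (0 : ℝ), logKernel x y • f y) := by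
  simp_rw [sub_smul]
  exact HasIoiIntegral.sub ⟨hf.integrableOn_stieltjesKernel hx, rfl⟩
    ⟨hf.integrableOn_logKernel hx, rfl⟩

theorem hasIoiIntegral_stieltjesKernel_logKernel (hf : MemE f) (hx : 0 < x) :
    HasIoiIntegral (fun z => stieltjesKernel x z • ∫ y in Ioi (0 : ℝ), logKernel z y • f y)
      ((∫ y in Ioi (0 : ℝ), stieltjesKernel x y • f y)
        - ∫ y in Ioi (0 : ℝ), logKernel x y • f y) := by
  refine HasIoiIntegral.kernel_comp (measurable_stieltjesKernel.comp measurable_prodMk_left)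
    measurable_logKernel (fun z hz => stieltjesKernel_nonneg hx hz)
    (fun z y hz hy => logKernel_nonneg hz hy) hf.aestronglyMeasurable ?_
    (hf.hasIoiIntegral_sub_smul hx)
  filter_upwards [ae_Ioi_pos_ne x] with y ⟨hy, hxy⟩
  exact hasIoiIntegral_stieltjesKernel_mul_logKernel hx hy hxy

theorem hasIoiIntegral_logKernel_stieltjesKernel (hf : MemE f) (hx : 0 < x) :
    HasIoiIntegral (fun z => logKernel x z • ∫ y in Ioi (0 : ℝ), stieltjesKernel z y • f y)
      ((∫ y in Ioi (0 : ℝ), stieltjesKernel x y • f y)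
        - ∫ y in Ioi (0 : ℝ), logKernel x y • f y) := by
  refine HasIoiIntegral.kernel_comp (measurable_logKernel.comp measurable_prodMk_left)
    measurable_stieltjesKernel (fun z hz => logKernel_nonneg hx hz)
    (fun z y hz hy => stieltjesKernel_nonneg hz hy) hf.aestronglyMeasurable ?_
    (hf.hasIoiIntegral_sub_smul hx)
  filter_upwards [ae_Ioi_pos_ne x] with y ⟨hy, hxy⟩
  exact hasIoiIntegral_logKernel_mul_stieltjesKernel hx hy hxy

end MemE

/-- The Stieltjes equation in `E` is inverted by `logKernel`. -/
theorem stieltjes_equation_iff {f g : ℝ → ℂ} (hf : MemE f) (hg : MemE g) :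
    (∀ᵐ x ∂volume.restrict (Ioi (0 : ℝ)),
        f x = g x - ∫ y in Ioi (0 : ℝ), stieltjesKernel x y • f y) ↔
      ∀ᵐ x ∂volume.restrict (Ioi (0 : ℝ)),
        f x = g x - ∫ y in Ioi (0 : ℝ), logKernel x y • g y := by
  constructor <;> intro h <;>
    filter_upwards [h, ae_restrict_mem measurableSet_Ioi] with x hfx (hx : 0 < x) <;>
    rw [hfx] <;> congr 1
  · have h1 := (HasIoiIntegral.add ⟨hf.integrableOn_logKernel hx, rfl⟩
      (hf.hasIoiIntegral_logKernel_stieltjesKernel hx)).congr_ae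
      (g := fun y => logKernel x y • g y) <| by
        filter_upwards [h] with y hy
        rw [hy, ← smul_add, sub_add_cancel]
    rw [h1.2, add_sub_cancel]
  · have h1 := (HasIoiIntegral.sub ⟨hg.integrableOn_stieltjesKernel hx, rfl⟩
      (hg.hasIoiIntegral_stieltjesKernel_logKernel hx)).congr_ae
      (g := fun y => stieltjesKernel x y • f y) <| by
        filter_upwards [h] with y hy
        rw [hy, ← smul_sub]
    rw [h1.2, sub_sub_cancel]

theorem div_add_eq_stieltjesKernel_smul (x y : ℝ) (c : ℂ) :
    c / ((x : ℂ) + (y : ℂ)) = (Real.pi : ℂ) * (stieltjesKernel x y • c) := by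
  have hpi : (Real.pi : ℂ) ≠ 0 := by exact_mod_cast Real.pi_ne_zero
  rw [stieltjesKernel, Complex.real_smul]
  push_cast
  field_simp

theorem kernel_mul_eq_logKernel_smul {x y : ℝ} (hx : 0 < x) (hy : 0 < y) (c : ℂ) :
    1 / ((x : ℂ) ^ 2 - (y : ℂ) ^ 2) * ((y / x : ℝ) : ℂ) ^ ((1 : ℂ) / 2) *
        (Real.log (y / x) : ℂ) * c
      = -((Real.pi : ℂ) ^ 2 / (2 * (x : ℂ))) * (logKernel x y • c) := by
  have h1 : ((y / x : ℝ) : ℂ) ^ ((1 : ℂ) / 2) = ((√(x * y) / x : ℝ) : ℂ) := by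
    rw [show √(x * y) / x = √(y / x) by
      rw [Real.sqrt_mul hx.le, Real.sqrt_div hy.le]
      have := Real.sq_sqrt hx.le
      have := Real.sqrt_pos.2 hx
      field_simp
      nlinarith,
      Real.sqrt_eq_rpow, Complex.ofReal_cpow (by positivity)]
    norm_num
  have hpi : (Real.pi : ℂ) ≠ 0 := by exact_mod_cast Real.pi_ne_zero
  have hx' : (x : ℂ) ≠ 0 := by exact_mod_cast hx.ne'
  rw [h1, logKernel, Complex.real_smul]
  push_cast
  rw [← neg_sub ((y : ℂ) ^ 2), one_div, inv_neg]
  field_simp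

/-- Theorem 1(ii): for `λ = -1/π` and `g ∈ E`, a function `f ∈ E`
satisfies the Stieltjes equation a.e. iff
`f(x) = g(x) + (2/π²)·x·∫₀^∞ (y/x)^{1/2}·ln(y/x)/(x²-y²)·g(y) dy` a.e. -/
theorem stmt10 (lam : ℂ) (hlam : lam = -(1 / (Real.pi : ℂ)))
    (g : ℝ → ℂ) (hg : MemE g) (f : ℝ → ℂ) (hf : MemE f) :
    ((∀ x : ℝ, 0 < x → IntegrableOn (fun y : ℝ => f y / ((x : ℂ) + (y : ℂ))) (Ioi 0)) ∧
      (∀ᵐ x ∂(volume.restrict (Ioi (0 : ℝ))),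
        f x = g x + lam * ∫ y in Ioi (0 : ℝ), f y / ((x : ℂ) + (y : ℂ))))
    ↔
    ((∀ x : ℝ, 0 < x → IntegrableOn (fun y : ℝ =>
        1 / ((x : ℂ) ^ 2 - (y : ℂ) ^ 2) * ((y / x : ℝ) : ℂ) ^ ((1 : ℂ)/2) *
          (Real.log (y / x) : ℂ) * g y) (Ioi 0)) ∧
      (∀ᵐ x ∂(volume.restrict (Ioi (0 : ℝ))),
        f x = g x + 2 / (Real.pi : ℂ) ^ 2 * (x : ℂ) *
          ∫ y in Ioi (0 : ℝ),
            1 / ((x : ℂ) ^ 2 - (y : ℂ) ^ 2) * ((y / x : ℝ) : ℂ) ^ ((1 : ℂ)/2) *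
              (Real.log (y / x) : ℂ) * g y)) := by
  have hpi : (Real.pi : ℂ) ≠ 0 := by exact_mod_cast Real.pi_ne_zero
  have hpos : ∀ᵐ x ∂volume.restrict (Ioi (0 : ℝ)), 0 < x := ae_restrict_mem measurableSet_Ioi
  have hT (x : ℝ) : ∫ y in Ioi (0 : ℝ), f y / ((x : ℂ) + (y : ℂ))
      = Real.pi * ∫ y in Ioi (0 : ℝ), stieltjesKernel x y • f y := by
    simp_rw [div_add_eq_stieltjesKernel_smul]
    exact integral_const_mul _ _
  have hK (x : ℝ) (hx : 0 < x) := setIntegral_congr_fun (μ := volume) measurableSet_Ioi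
    fun y (hy : 0 < y) => kernel_mul_eq_logKernel_smul hx hy (g y)
  rw [and_iff_right fun x hx => ?_, and_iff_right fun x hx => ?_]
  · convert stieltjes_equation_iff hf hg using 1
    · refine Filter.eventually_congr (.of_forall fun x => ?_)
      rw [hT, hlam, neg_mul, ← mul_assoc, one_div_mul_cancel hpi, one_mul, sub_eq_add_neg]
    · refine Filter.eventually_congr ?_
      filter_upwards [hpos] with x hx
      have hx' : (x : ℂ) ≠ 0 := by exact_mod_cast hx.ne'
      rw [hK x hx, integral_const_mul, ← mul_assoc, sub_eq_add_neg]
      have : 2 / (Real.pi : ℂ) ^ 2 * (x : ℂ) * -((Real.pi : ℂ) ^ 2 / (2 * (x : ℂ))) = -1 := by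
        field_simp
      rw [this, neg_one_mul]
  · exact IntegrableOn.congr_fun ((hg.integrableOn_logKernel hx).const_mul _)
      (fun y hy => (kernel_mul_eq_logKernel_smul hx hy (g y)).symm) measurableSet_Ioi
  · simp_rw [div_add_eq_stieltjesKernel_smul]
    exact (hf.integrableOn_stieltjesKernel hx).const_mul _

end
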